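/- arXiv:2511.02813 — 2 statements merged into one kernel-verified Lean document; each statement's English description precedes it below -/
import Mathlib

section
/- Let q be a prime power, ℓ ≥ 1, and let v = (v_1, …, v_ℓ) ∈ F_{q^2}^ℓ. If the one-generator code C = span_{F_{q^2}}{v} is Galois closed, then there exists β ∈ F_{q^2} such that for every index i, either v_i = 0 or v_i^{q−1} = β. -/
open Polynomial

/-- Hamming weight of a vector. -/
noncomputable def wt {R : Type*} [Zero R] {n : ℕ} (v : Fin n → R) : ℕ :=
  Nat.card {i : Fin n // v i ≠ 0}

/-- Minimum distance of a (set-theoretic) code: the least Hamming weight of a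
nonzero codeword. -/
noncomputable def minDist {R : Type*} [Zero R] {n : ℕ} (C : Set (Fin n → R)) : ℕ :=
  sInf {w : ℕ | ∃ v ∈ C, v ≠ (0 : Fin n → R) ∧ wt v = w}

/-- Euclidean dual of a set of vectors. -/
def dualE {R : Type*} [CommRing R] {n : ℕ} (S : Set (Fin n → R)) :
    Submodule R (Fin n → R) where
  carrier := {x | ∀ c ∈ S, ∑ i, x i * c i = 0}
  add_mem' := by
    intro a b ha hb c hc
    have h1 := ha c hc
    have h2 := hb c hc
    simp only [Pi.add_apply, add_mul]
    rw [Finset.sum_add_distrib, h1, h2, add_zero]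
  zero_mem' := by
    intro c hc
    simp
  smul_mem' := by
    intro r a ha c hc
    have h := ha c hc
    simp only [Pi.smul_apply, smul_eq_mul, mul_assoc]
    rw [← Finset.mul_sum, h, mul_zero]

/-- Hermitian dual (with conjugation `x ↦ x ^ e`) of a set of vectors. -/
def dualH {R : Type*} [CommRing R] (e : ℕ) {n : ℕ} (S : Set (Fin n → R)) :
    Submodule R (Fin n → R) where
  carrier := {x | ∀ c ∈ S, ∑ i, x i * (c i) ^ e = 0}
  add_mem' := by
    intro a b ha hb c hc
    have h1 := ha c hc
    have h2 := hb c hc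
    simp only [Pi.add_apply, add_mul]
    rw [Finset.sum_add_distrib, h1, h2, add_zero]
  zero_mem' := by
    intro c hc
    simp
  smul_mem' := by
    intro r a ha c hc
    have h := ha c hc
    simp only [Pi.smul_apply, smul_eq_mul, mul_assoc]
    rw [← Finset.mul_sum, h, mul_zero]

/-- Cyclic shift by `k` positions on vectors of length `N`. -/
def cshift {R : Type*} {N : ℕ} (k : ℕ) (v : Fin N → R) : Fin N → R :=
  fun i => v ⟨((i : ℕ) + k) % N, Nat.mod_lt _ i.pos⟩

/-- A code `C ⊆ R^N` is quasi-cyclic of index `ℓ` if `T^ℓ(C) = C`. -/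
def IsQuasiCyclic {R : Type*} {N : ℕ} (ℓ : ℕ) (C : Set (Fin N → R)) : Prop :=
  cshift ℓ '' C = C

/-- Componentwise `q`-power (Frobenius) image of a code. -/
def frobImage {R : Type*} [Monoid R] (q : ℕ) {n : ℕ} (C : Set (Fin n → R)) :
    Set (Fin n → R) :=
  (fun v => fun i => (v i) ^ q) '' C

/-- A code is Galois closed if `C^q = C`. -/
def GaloisClosed {R : Type*} [Monoid R] (q : ℕ) {n : ℕ} (C : Set (Fin n → R)) : Prop :=
  frobImage q C = C

/-- If a one-generator code over `F_{q^2}` is Galois closed, then all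
nonzero entries of the generator have the same `(q-1)`-th power. -/
theorem stmt8
    (p e q ℓ : ℕ) (hp : p.Prime) (he : 0 < e) (hq : q = p ^ e) (hl : 0 < ℓ)
    (F : Type*) [Field F] [Fintype F] (hF : Fintype.card F = q ^ 2)
    (v : Fin ℓ → F)
    (hGC : GaloisClosed q
      ((Submodule.span F {v} : Submodule F (Fin ℓ → F)) : Set (Fin ℓ → F))) :
    ∃ β : F, ∀ i : Fin ℓ, v i = 0 ∨ (v i) ^ (q - 1) = β := by
  have hmem : (fun i => v i ^ q) ∈ Submodule.span F {v} := by
    rw [← SetLike.mem_coe, ← hGC]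
    exact ⟨v, Submodule.mem_span_singleton_self v, rfl⟩
  obtain ⟨β, hβ⟩ := Submodule.mem_span_singleton.mp hmem
  have hq0 : q ≠ 0 := hq ▸ pow_ne_zero e hp.ne_zero
  refine ⟨β, fun i => or_iff_not_imp_left.mpr fun hi => mul_right_cancel₀ hi ?_⟩
  rw [pow_sub_one_mul hq0]
  exact (congrFun hβ i).symm
end

section
/- Let q be a prime power, ℓ ≥ 1, and let C ⊆ F_{q^2}^ℓ be a linear code of dimension k. Then C is Galois closed if and only if there exist one-dimensional Galois closed subcodes C_1, …, C_k of F_{q^2}^ℓ whose internal direct sum is C, i.e., C = C_1 ⊕ ⋯ ⊕ C_k. -/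
open Polynomial

/-- The componentwise action of a ring endomorphism `σ`, as a `σ`-semilinear map. -/
def piSemilinear {R : Type*} [CommSemiring R] (σ : R →+* R) (n : ℕ) :
    (Fin n → R) →ₛₗ[σ] (Fin n → R) where
  toFun v i := σ (v i)
  map_add' _ _ := by ext; simp
  map_smul' _ _ := by ext; simp

@[simp]
theorem piSemilinear_apply {R : Type*} [CommSemiring R] (σ : R →+* R) {n : ℕ}
    (v : Fin n → R) (i : Fin n) : piSemilinear σ n v i = σ (v i) := rfl

section Field

variable {F : Type*} [Field F] {q n : ℕ} {σ : F →+* F}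

theorem galoisClosed_iff_le_comap (hσ : ∀ x, σ x = x ^ q) (hinv : ∀ x, σ (σ x) = x)
    (C : Submodule F (Fin n → F)) :
    GaloisClosed q (C : Set (Fin n → F)) ↔ C ≤ C.comap (piSemilinear σ n) := by
  have himage : frobImage q (C : Set (Fin n → F)) = piSemilinear σ n '' C := by
    unfold frobImage
    congr 1
    ext v i
    simp [hσ]
  rw [GaloisClosed, himage]
  constructor
  · intro h v hv
    have hmem : piSemilinear σ n v ∈ piSemilinear σ n '' (C : Set (Fin n → F)) := ⟨v, hv, rfl⟩
    rwa [h] at hmem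
  · intro h
    apply Set.Subset.antisymm
    · rintro _ ⟨v, hv, rfl⟩
      exact h hv
    · intro v hv
      exact ⟨piSemilinear σ n v, h hv, by ext; simp [hinv]⟩

/-- A subspace stable under a nontrivial involution `σ` is spanned by its fixed vectors. -/
theorem span_fixed_eq (hinv : ∀ x, σ (σ x) = x) {α : F} (hα : σ α ≠ α)
    {C : Submodule F (Fin n → F)} (hC : C ≤ C.comap (piSemilinear σ n)) :
    Submodule.span F {v | v ∈ C ∧ piSemilinear σ n v = v} = C := by
  apply le_antisymm
  · exact Submodule.span_le.2 fun v hv => hv.1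
  · intro v hv
    have trace_mem : ∀ w ∈ C, w + piSemilinear σ n w ∈
        Submodule.span F {v | v ∈ C ∧ piSemilinear σ n v = v} := fun w hw =>
      Submodule.subset_span ⟨C.add_mem hw (hC hw), by ext; simp [hinv, add_comm]⟩
    have hcomb := Submodule.sub_mem _ (trace_mem (α • v) (C.smul_mem α hv))
      (Submodule.smul_mem _ (σ α) (trace_mem v hv))
    have heq : α • v + piSemilinear σ n (α • v) - σ α • (v + piSemilinear σ n v)
        = (α - σ α) • v := by
      ext i
      simp
      ring
    rw [heq] at hcomb
    exact (Submodule.smul_mem_iff _ (sub_ne_zero.2 hα.symm)).1 hcomb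

theorem exists_pow_ne_self [Fintype F] (hq : 1 < q) (hcard : q < Fintype.card F) :
    ∃ α : F, α ^ q ≠ α := by
  by_contra! h
  have hdeg := FiniteField.X_pow_card_sub_X_natDegree_eq F hq
  have hzero : (X ^ q - X : F[X]) = 0 :=
    Polynomial.eq_zero_of_natDegree_lt_card_of_eval_eq_zero _ Function.injective_id
      (fun x => by simp [h]) (by rwa [hdeg])
  rw [hzero, natDegree_zero] at hdeg
  omega

end Field

/-- A code over `F_{q^2}` of dimension `k` is Galois closed iff it is
an internal direct sum of `k` one-dimensional Galois closed subcodes. -/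
theorem stmt9
    (p e q ℓ k : ℕ) (hp : p.Prime) (he : 0 < e) (hq : q = p ^ e) (hl : 0 < ℓ)
    (F : Type*) [Field F] [Fintype F] (hF : Fintype.card F = q ^ 2)
    (C : Submodule F (Fin ℓ → F)) (hk : Module.finrank F C = k) :
    GaloisClosed q (C : Set (Fin ℓ → F)) ↔
      ∃ Ci : Fin k → Submodule F (Fin ℓ → F),
        (∀ i, Module.finrank F (Ci i) = 1 ∧
          GaloisClosed q ((Ci i : Set (Fin ℓ → F)))) ∧
        iSupIndep Ci ∧
        (⨆ i, Ci i) = C := by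
  have : Fact p.Prime := ⟨hp⟩
  have hq1 : 1 < q := hq ▸ Nat.one_lt_pow he.ne' hp.one_lt
  have : CharP F p := charP_of_card_eq_prime_pow (f := e * 2) (by
    rw [hF, hq, ← pow_mul])
  let σ : F →+* F := iterateFrobenius F p e
  have hσ : ∀ x, σ x = x ^ q := fun x => by rw [hq]; rfl
  have hinv : ∀ x, σ (σ x) = x := fun x => by
    rw [hσ, hσ, ← pow_mul, ← sq, ← hF, FiniteField.pow_card]
  obtain ⟨α, hα⟩ := exists_pow_ne_self (F := F) hq1 (by rw [hF]; nlinarith)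
  rw [← hσ] at hα
  simp only [galoisClosed_iff_le_comap hσ hinv]
  constructor
  · intro hC
    have hspan := span_fixed_eq hinv hα hC
    obtain ⟨f, hf, hfspan, hfind⟩ := Submodule.exists_fun_fin_finrank_span_eq F
      {v | v ∈ C ∧ piSemilinear σ ℓ v = v}
    have hrank : k =
        Module.finrank F (Submodule.span F {v | v ∈ C ∧ piSemilinear σ ℓ v = v}) := by
      rw [hspan, hk]
    subst hrank
    refine ⟨fun i => Submodule.span F {f i}, fun i => ⟨finrank_span_singleton (hfind.ne_zero i), ?_⟩,
      hfind.iSupIndep_span_singleton, ?_⟩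
    · rw [Submodule.span_singleton_le_iff_mem, Submodule.mem_comap, (hf i).2]
      exact Submodule.mem_span_singleton_self _
    · rw [← Submodule.span_range_eq_iSup, hfspan, hspan]
  · rintro ⟨Ci, hCi, -, rfl⟩
    exact iSup_le fun i => (hCi i).2.trans (Submodule.comap_mono (le_iSup Ci i))
end
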